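/- Let n ≥ 1, let a¹, a² be symmetric positive definite n×n real matrices, and let c¹, c² > 0 be real constants. For p ∈ [0,1] set B_p = p·a¹ + (1−p)·a², T_p = p·c¹ + (1−p)·c², and Q_p(x) = ⟨B_p⁻¹ x, x⟩ for x ∈ ℝⁿ. Define λ : (0,∞) × ℝⁿ → ℝ by λ(t,x) = sup_{p∈[0,1]} ( t·T_p − Q_p(x)/(2t) ). Then λ is superadditive: for all t₁, t₂ > 0 and x₁, x₂ ∈ ℝⁿ, λ(t₁ + t₂, x₁ + x₂) ≥ λ(t₁, x₁) + λ(t₂, x₂). -/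

import Mathlib

open Matrix

/-- The convex combination `B_p = p·a¹ + (1−p)·a²` of the diffusion matrices. -/
noncomputable def Bp {n : ℕ} (a1 a2 : Matrix (Fin n) (Fin n) ℝ) (p : ℝ) :
    Matrix (Fin n) (Fin n) ℝ :=
  p • a1 + (1 - p) • a2

/-- The convex combination `T_p = p·c¹ + (1−p)·c²` of the reaction rates. -/
noncomputable def Tp (c1 c2 p : ℝ) : ℝ := p * c1 + (1 - p) * c2

/-- The quadratic form `Q_p(x) = ⟨B_p⁻¹ x, x⟩`. -/
noncomputable def Qp {n : ℕ} (a1 a2 : Matrix (Fin n) (Fin n) ℝ) (p : ℝ)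
    (x : Fin n → ℝ) : ℝ :=
  (Bp a1 a2 p)⁻¹.mulVec x ⬝ᵥ x

/-- `λ(t,x) = sup_{p ∈ [0,1]} ( t·T_p − Q_p(x)/(2t) )`, formula (gtmo) of the paper. -/
noncomputable def lam {n : ℕ} (a1 a2 : Matrix (Fin n) (Fin n) ℝ) (c1 c2 : ℝ)
    (t : ℝ) (x : Fin n → ℝ) : ℝ :=
  ⨆ p : Set.Icc (0 : ℝ) 1, (t * Tp c1 c2 p - Qp a1 a2 (p : ℝ) x / (2 * t))

theorem Bp_posDef {n : ℕ} {a1 a2 : Matrix (Fin n) (Fin n) ℝ}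
    (ha1 : a1.PosDef) (ha2 : a2.PosDef) {p : ℝ} (h0 : 0 ≤ p) (h1 : p ≤ 1) :
    (Bp a1 a2 p).PosDef := by
  unfold Bp
  rcases h0.eq_or_lt with h | h
  · subst h; simpa using ha2
  · exact (ha1.smul h).add_posSemidef (ha2.posSemidef.smul (by linarith))

theorem quad_bound {n : ℕ} {B : Matrix (Fin n) (Fin n) ℝ} (hB : B.PosDef)
    {t : ℝ} (ht : 0 < t) (x y : Fin n → ℝ) :
    2 * (x ⬝ᵥ y) - t * (y ⬝ᵥ B *ᵥ y) ≤ (B⁻¹ *ᵥ x ⬝ᵥ x) / t := by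
  have hu : IsUnit B.det := (Matrix.isUnit_iff_isUnit_det B).mp hB.isUnit
  obtain ⟨w, hw⟩ : ∃ w, w = B⁻¹ *ᵥ x := ⟨_, rfl⟩
  have hx : B *ᵥ w = x := by rw [hw, mulVec_mulVec, Matrix.mul_nonsing_inv _ hu, one_mulVec]
  have hpos : 0 ≤ (t • y - w) ⬝ᵥ B *ᵥ (t • y - w) := by
    simpa using hB.posSemidef.dotProduct_mulVec_nonneg (t • y - w)
  have hsym : w ⬝ᵥ B *ᵥ y = x ⬝ᵥ y := by
    have hT : Bᵀ = B := by simpa using hB.isHermitian.eq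
    rw [dotProduct_mulVec, ← mulVec_transpose, hT, hx]
  rw [← hw, le_div_iff₀ ht]
  simp only [mulVec_sub, mulVec_smul, hx, sub_dotProduct, dotProduct_sub, smul_dotProduct,
    dotProduct_smul, smul_eq_mul, hsym] at hpos
  rw [dotProduct_comm y x] at hpos
  nlinarith [hpos]

theorem quad_eq {n : ℕ} {B : Matrix (Fin n) (Fin n) ℝ} (hB : B.PosDef)
    {t : ℝ} (ht : 0 < t) (x : Fin n → ℝ) :
    ∃ y, 2 * (x ⬝ᵥ y) - t * (y ⬝ᵥ B *ᵥ y) = (B⁻¹ *ᵥ x ⬝ᵥ x) / t := by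
  have hu : IsUnit B.det := (Matrix.isUnit_iff_isUnit_det B).mp hB.isUnit
  obtain ⟨w, hw⟩ : ∃ w, w = B⁻¹ *ᵥ x := ⟨_, rfl⟩
  have hx : B *ᵥ w = x := by rw [hw, mulVec_mulVec, Matrix.mul_nonsing_inv _ hu, one_mulVec]
  refine ⟨t⁻¹ • w, ?_⟩
  rw [← hw]
  simp only [mulVec_smul, hx, smul_dotProduct, dotProduct_smul, smul_eq_mul]
  rw [dotProduct_comm x w]
  field_simp
  ring

theorem lam_bdd {n : ℕ} {a1 a2 : Matrix (Fin n) (Fin n) ℝ}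
    (ha1 : a1.PosDef) (ha2 : a2.PosDef)
    {c1 c2 : ℝ} (hc1 : 0 < c1) (hc2 : 0 < c2) {t : ℝ} (ht : 0 < t) (x : Fin n → ℝ) :
    BddAbove (Set.range fun p : Set.Icc (0 : ℝ) 1 =>
      (t * Tp c1 c2 p - Qp a1 a2 (p : ℝ) x / (2 * t))) := by
  refine ⟨t * (c1 + c2), ?_⟩
  rintro _ ⟨⟨p, h0, h1⟩, rfl⟩
  have hq := quad_bound (Bp_posDef ha1 ha2 h0 h1) (t := 2 * t) (by linarith) x 0
  simp only [dotProduct_zero, zero_dotProduct, mul_zero, sub_zero] at hq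
  have hT : Tp c1 c2 p ≤ c1 + c2 := by unfold Tp; nlinarith
  have := mul_le_mul_of_nonneg_left hT ht.le
  simp only [Qp]
  linarith

/-- Superadditivity of `λ` (inequality (conv1) of the paper):
`λ(t₁+t₂, x₁+x₂) ≥ λ(t₁,x₁) + λ(t₂,x₂)`. -/
theorem lam_superadditive
    (n : ℕ) (hn : 1 ≤ n) (a1 a2 : Matrix (Fin n) (Fin n) ℝ)
    (ha1 : a1.PosDef) (ha2 : a2.PosDef)
    (c1 c2 : ℝ) (hc1 : 0 < c1) (hc2 : 0 < c2) :
    ∀ t1 t2 : ℝ, 0 < t1 → 0 < t2 → ∀ x1 x2 : Fin n → ℝ,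
      lam a1 a2 c1 c2 t1 x1 + lam a1 a2 c1 c2 t2 x2 ≤
        lam a1 a2 c1 c2 (t1 + t2) (x1 + x2) := by
  intro t1 t2 ht1 ht2 x1 x2
  haveI : Nonempty (Set.Icc (0 : ℝ) 1) := ⟨⟨0, by simp⟩⟩
  rw [← le_sub_iff_add_le]
  refine ciSup_le ?_
  rintro ⟨p, hp0, hp1⟩
  rw [le_sub_comm]
  refine ciSup_le ?_
  rintro ⟨q, hq0, hq1⟩
  rw [le_sub_iff_add_le']
  have ht : 0 < t1 + t2 := by linarith
  obtain ⟨r, hr⟩ : ∃ r, (t1 + t2) * r = t1 * p + t2 * q :=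
    ⟨(t1 * p + t2 * q) / (t1 + t2), by field_simp⟩
  have hr0 : 0 ≤ r := by
    by_contra h
    nlinarith [mul_nonneg ht1.le hp0, mul_nonneg ht2.le hq0]
  have hr1 : r ≤ 1 := by
    by_contra h
    nlinarith [mul_nonneg ht1.le (sub_nonneg.2 hp1), mul_nonneg ht2.le (sub_nonneg.2 hq1)]
  refine le_trans ?_ (le_ciSup (lam_bdd ha1 ha2 hc1 hc2 ht (x1 + x2)) ⟨r, hr0, hr1⟩)
  obtain ⟨y, hy⟩ := quad_eq (Bp_posDef ha1 ha2 hr0 hr1) ht (x1 + x2)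
  have e1 := quad_bound (Bp_posDef ha1 ha2 hp0 hp1) ht1 x1 y
  have e2 := quad_bound (Bp_posDef ha1 ha2 hq0 hq1) ht2 x2 y
  have hd : ∀ s z : ℝ, z / (2 * s) = z / s / 2 := fun s z => by
    rw [mul_comm, div_mul_eq_div_div]
  simp only [Qp, hd, Tp]
  rw [← hy]
  simp only [Bp, add_mulVec, smul_mulVec, dotProduct_add, add_dotProduct, dotProduct_smul,
    smul_eq_mul] at e1 e2 ⊢
  generalize y ⬝ᵥ a1 *ᵥ y = A at *
  generalize y ⬝ᵥ a2 *ᵥ y = C at *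
  have k1 : (t1 + t2) * (r * c1 + (1 - r) * c2) =
      t1 * (p * c1 + (1 - p) * c2) + t2 * (q * c1 + (1 - q) * c2) := by
    linear_combination (c1 - c2) * hr
  have k2 : (t1 + t2) * (r * A + (1 - r) * C) =
      t1 * (p * A + (1 - p) * C) + t2 * (q * A + (1 - q) * C) := by
    linear_combination (A - C) * hr
  rw [k1, k2]
  linarith
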